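/- Let H₁ and H₂ be complex Hilbert spaces, let P₁ ⊆ H₁ and P₂ ⊆ H₂ be self-dual cones, and let ρ : H₁ → H₂ be a complex-linear isometry with ρ(P₁) ⊆ P₂. Put e := ρ ∘ ρ*, the orthogonal projection of H₂ onto the range of ρ. Then ρ(P₁) = e(P₂) = P₂ ∩ ρ(H₁); in particular e(P₂) ⊆ P₂. -/

import Mathlib

open scoped ComplexInnerProductSpace ComplexOrder

/-- The dual cone of a subset `P` of a complex Hilbert space:
all vectors `ξ` such that `⟪ξ, η⟫` is a nonnegative real number for every `η ∈ P`. -/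
def dualCone {H : Type*} [NormedAddCommGroup H] [InnerProductSpace ℂ H] (P : Set H) : Set H :=
  {ξ : H | ∀ η ∈ P, 0 ≤ ⟪ξ, η⟫}

/-- A self-dual cone in a complex Hilbert space: a closed convex cone `P` with `P = P⁰`. -/
def IsSelfDualCone {H : Type*} [NormedAddCommGroup H] [InnerProductSpace ℂ H] (P : Set H) : Prop :=
  IsClosed P ∧ Convex ℝ P ∧ (∀ (c : ℝ), 0 ≤ c → ∀ x ∈ P, c • x ∈ P) ∧ P = dualCone P

/-- If `P₁ ⊆ H₁` and `P₂ ⊆ H₂` are self-dual cones and `ρ : H₁ → H₂` is a complex-linear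
isometry with `ρ(P₁) ⊆ P₂`, then, with `e := ρ ∘ ρ*` the orthogonal projection onto the
range of `ρ`, one has `ρ(P₁) = e(P₂) = P₂ ∩ ρ(H₁)`; in particular `e(P₂) ⊆ P₂`. -/
theorem image_cone_eq_proj_image_cone
    {H₁ H₂ : Type*} [NormedAddCommGroup H₁] [InnerProductSpace ℂ H₁] [CompleteSpace H₁]
    [NormedAddCommGroup H₂] [InnerProductSpace ℂ H₂] [CompleteSpace H₂]
    (P₁ : Set H₁) (P₂ : Set H₂) (hP₁ : IsSelfDualCone P₁) (hP₂ : IsSelfDualCone P₂)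
    (ρ : H₁ →ₗᵢ[ℂ] H₂) (hρ : ρ '' P₁ ⊆ P₂)
    (e : H₂ → H₂)
    (he : e = fun ξ => ρ (ContinuousLinearMap.adjoint ρ.toContinuousLinearMap ξ)) :
    ρ '' P₁ = e '' P₂ ∧ e '' P₂ = P₂ ∩ (Set.range ρ) ∧ e '' P₂ ⊆ P₂ := by
  have adj_apply (x : H₁) : ContinuousLinearMap.adjoint ρ.toContinuousLinearMap (ρ x) = x :=
    ext_inner_right ℂ fun y => by
      rw [ContinuousLinearMap.adjoint_inner_left]
      exact ρ.inner_map_map x y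
  have adj_mem {ξ : H₂} (hξ : ξ ∈ P₂) :
      ContinuousLinearMap.adjoint ρ.toContinuousLinearMap ξ ∈ P₁ := by
    rw [hP₁.2.2.2]
    intro η hη
    rw [ContinuousLinearMap.adjoint_inner_left]
    rw [hP₂.2.2.2] at hξ
    exact hξ _ (hρ ⟨η, hη, rfl⟩)
  have image_eq : ρ '' P₁ = e '' P₂ := by
    subst he
    apply Set.Subset.antisymm
    · rintro _ ⟨x, hx, rfl⟩
      exact ⟨ρ x, hρ ⟨x, hx, rfl⟩, congrArg ρ (adj_apply x)⟩
    · rintro _ ⟨ξ, hξ, rfl⟩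
      exact ⟨_, adj_mem hξ, rfl⟩
  refine ⟨image_eq, ?_, image_eq ▸ hρ⟩
  rw [← image_eq]
  apply Set.Subset.antisymm
  · exact Set.subset_inter hρ (Set.image_subset_range ρ P₁)
  · rintro _ ⟨hx, x, rfl⟩
    exact ⟨x, adj_apply x ▸ adj_mem hx, rfl⟩
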